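/- Assume that f : A^n → B is invariant under a permutation σ of {1,…,n}, i.e., f(a ∘ σ) = f(a) for all a ∈ A^n. Then for every 2-element subset I of {1,…,n}, the identification minors f_I and f_{Iσ} are equivalent, where Iσ = {σ(i) : i ∈ I}. -/

import Mathlib

theorem two_card_nonempty {n : ℕ} {I : Finset (Fin n)} (hI : I.card = 2) : I.Nonempty :=
  Finset.card_pos.mp (by omega)

theorem min'_lt_max'_two {n : ℕ} {I : Finset (Fin n)} (hI : I.card = 2) :
    (I.min' (two_card_nonempty hI)).val < (I.max' (two_card_nonempty hI)).val :=
  Fin.lt_def.mp (I.min'_lt_max'_of_card (by omega))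

theorem min'_lt_pred {n : ℕ} {I : Finset (Fin n)} (hI : I.card = 2) :
    (I.min' (two_card_nonempty hI)).val < n - 1 := by
  have h1 := min'_lt_max'_two hI
  have h2 : (I.max' (two_card_nonempty hI)).val < n := (I.max' (two_card_nonempty hI)).isLt
  omega

/-- The identification map `δ_I : Fin n → Fin (n-1)` associated with a 2-element
subset `I` of `Fin n`: it is the identity below `max I`, sends `max I` to `min I`,
and shifts everything above `max I` down by one. -/
def deltaMap {n : ℕ} (I : Finset (Fin n)) (hI : I.card = 2) : Fin n → Fin (n - 1) := fun t =>
  if h1 : (t : ℕ) < (I.max' (two_card_nonempty hI)).val then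
    ⟨(t : ℕ), by have h2 := (I.max' (two_card_nonempty hI)).isLt; omega⟩
  else if h2 : (t : ℕ) = (I.max' (two_card_nonempty hI)).val then
    ⟨(I.min' (two_card_nonempty hI)).val, min'_lt_pred hI⟩
  else
    ⟨(t : ℕ) - 1, by
      have h3 := min'_lt_max'_two hI
      have h4 := t.isLt
      have h5 := (I.max' (two_card_nonempty hI)).isLt
      omega⟩

/-- The identification minor `f_I` of `f`, obtained by identifying the arguments indexed
by the 2-element set `I`. -/
def minor {A B : Type*} {n : ℕ} (f : (Fin n → A) → B) (I : Finset (Fin n)) (hI : I.card = 2) :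
    (Fin (n - 1) → A) → B := fun a => f (fun t => a (deltaMap I hI t))

/-- Two `m`-ary functions are equivalent if one is obtained from the other by
permutation of arguments. -/
def FEquiv {A B : Type*} {m : ℕ} (f g : (Fin m → A) → B) : Prop :=
  ∃ σ : Equiv.Perm (Fin m), ∀ a : Fin m → A, f a = g (fun t => a (σ t))

/-- `g` is a reconstruction of `f`: there is a bijection `φ` of the 2-element subsets
of `Fin n` such that `f_I ≡ g_{φ(I)}` for every such subset `I`. -/
def IsReconstruction {A B : Type*} {n : ℕ} (f g : (Fin n → A) → B) : Prop :=
  ∃ φ : {I : Finset (Fin n) // I.card = 2} ≃ {I : Finset (Fin n) // I.card = 2},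
    ∀ I : {I : Finset (Fin n) // I.card = 2},
      FEquiv (minor f I.1 I.2) (minor g (φ I).1 (φ I).2)

/-- A function is totally symmetric if it is invariant under all permutations of
its arguments. -/
def TotallySymmetric {A B : Type*} {n : ℕ} (f : (Fin n → A) → B) : Prop :=
  ∀ (σ : Equiv.Perm (Fin n)) (a : Fin n → A), f (fun t => a (σ t)) = f a

theorem mem_two_iff {n : ℕ} {I : Finset (Fin n)} (hI : I.card = 2) (t : Fin n) :
    t ∈ I ↔ t.val = (I.min' (two_card_nonempty hI)).val ∨
      t.val = (I.max' (two_card_nonempty hI)).val := by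
  have hlt := min'_lt_max'_two hI
  have hsub : ({I.min' (two_card_nonempty hI), I.max' (two_card_nonempty hI)} : Finset (Fin n))
      = I := by
    apply Finset.eq_of_subset_of_card_le
    · intro x hx
      rcases Finset.mem_insert.mp hx with h | h
      · rw [h]; exact Finset.min'_mem _ _
      · rw [Finset.mem_singleton.mp h]; exact Finset.max'_mem _ _
    · rw [hI, Finset.card_pair]
      intro h
      rw [h] at hlt
      exact lt_irrefl _ hlt
  rw [← Fin.ext_iff, ← Fin.ext_iff, ← Finset.mem_singleton (a := I.max' _), ← Finset.mem_insert,
    hsub]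

theorem deltaMap_eq_iff {n : ℕ} {I : Finset (Fin n)} (hI : I.card = 2) (s t : Fin n) :
    deltaMap I hI s = deltaMap I hI t ↔ s = t ∨ (s ∈ I ∧ t ∈ I) := by
  have hlt := min'_lt_max'_two hI
  rw [mem_two_iff hI, mem_two_iff hI, Fin.ext_iff, Fin.ext_iff]
  unfold deltaMap
  split_ifs <;> constructor <;> intro h <;> dsimp only at h ⊢ <;> omega

theorem deltaMap_surjective {n : ℕ} {I : Finset (Fin n)} (hI : I.card = 2) :
    Function.Surjective (deltaMap I hI) := by
  intro x
  have hx := x.isLt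
  by_cases h : x.val < (I.max' (two_card_nonempty hI)).val
  · refine ⟨⟨x.val, by omega⟩, ?_⟩
    simp [deltaMap, h]
  · refine ⟨⟨x.val + 1, by omega⟩, ?_⟩
    have h1 : ¬ (x.val + 1 < (I.max' (two_card_nonempty hI)).val) := by omega
    have h2 : ¬ (x.val + 1 = (I.max' (two_card_nonempty hI)).val) := by omega
    simp only [deltaMap, h1, h2, dite_false, Nat.add_sub_cancel]

/-- If `f` is invariant under a permutation `σ`, then the identification minors `f_I` and
`f_{Iσ}` are equivalent. -/
theorem invariant_minor_equiv {A B : Type*} {n : ℕ} (f : (Fin n → A) → B)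
    (σ : Equiv.Perm (Fin n)) (hσ : ∀ a : Fin n → A, f (fun t => a (σ t)) = f a)
    (I : Finset (Fin n)) (hI : I.card = 2) :
    FEquiv (minor f I hI)
      (minor f (I.image ⇑σ)
        ((Finset.card_image_of_injective I σ.injective).trans hI)) := by
  set J := I.image ⇑σ with hJdef
  have hJ : J.card = 2 := (Finset.card_image_of_injective I σ.injective).trans hI
  change FEquiv (minor f I hI) (minor f J hJ)
  have hmem : ∀ t, σ t ∈ J ↔ t ∈ I := fun t => by simp [hJdef]
  have hker : ∀ s t, deltaMap J hJ (σ s) = deltaMap J hJ (σ t) ↔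
      deltaMap I hI s = deltaMap I hI t := fun s t => by
    rw [deltaMap_eq_iff, deltaMap_eq_iff, hmem, hmem, σ.injective.eq_iff]
  have hsurj : Function.Surjective (fun t => deltaMap J hJ (σ t)) :=
    (deltaMap_surjective hJ).comp σ.surjective
  choose r hr using hsurj
  have hinj : Function.Injective (fun x => deltaMap I hI (r x)) := by
    intro x y hxy
    have h := (hker _ _).mpr hxy
    have hx := hr x
    have hy := hr y
    exact hx.symm.trans (h.trans hy)
  refine ⟨Equiv.ofBijective _ (Finite.injective_iff_bijective.mp hinj), fun a => ?_⟩
  unfold minor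
  refine Eq.trans ?_ (hσ _)
  congr 1
  funext t
  change a (deltaMap I hI t) = a (deltaMap I hI (r (deltaMap J hJ (σ t))))
  congr 1
  exact ((hker _ _).mp (hr (deltaMap J hJ (σ t)))).symm
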